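/- arXiv:2006.13840 — 2 statements merged into one kernel-verified Lean document; each statement's English description precedes it below -/
import Mathlib

section
/- For every real number y with 0 ≤ y ≤ π, sin y ≤ y - y³/10. -/
theorem nonneg_of_der_aux (f g : ℝ → ℝ) (h0 : f 0 = 0) (hd : ∀ x, HasDerivAt f (g x) x)
    (hg : ∀ x, 0 ≤ x → 0 ≤ g x) (x : ℝ) (hx : 0 ≤ x) : 0 ≤ f x := by
  have hm : MonotoneOn f (Set.Ici 0) := by
    apply monotoneOn_of_deriv_nonneg (convex_Ici 0)
    · exact fun z _ => (hd z).continuousAt.continuousWithinAt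
    · exact fun z _ => (hd z).differentiableAt.differentiableWithinAt
    · intro z hz
      rw [(hd z).deriv]
      rw [interior_Ici] at hz
      exact hg z (le_of_lt hz)
  have := hm (Set.mem_Ici.2 le_rfl) (Set.mem_Ici.2 hx) hx
  rwa [h0] at this

theorem cos_upper_aux (x : ℝ) (hx : 0 ≤ x) : 0 ≤ 1 - x ^ 2 / 2 + x ^ 4 / 24 - Real.cos x := by
  refine nonneg_of_der_aux (fun x => 1 - x ^ 2 / 2 + x ^ 4 / 24 - Real.cos x)
    (fun x => Real.sin x - (x - x ^ 3 / 6)) (by simp) ?_ ?_ x hx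
  · intro z
    have := ((((hasDerivAt_id z).pow 2).div_const 2).const_sub 1).add
      (((hasDerivAt_id z).pow 4).div_const 24) |>.sub (Real.hasDerivAt_cos z)
    refine this.congr_deriv ?_
    simp only [id, Nat.cast_ofNat]
    norm_num
    ring
  · intro z hz
    rcases hz.eq_or_lt with h | h
    · simp [← h]
    · linarith [Real.sin_gt_sub_cube h]

theorem sin_upper_aux (x : ℝ) (hx : 0 ≤ x) : 0 ≤ x - x ^ 3 / 6 + x ^ 5 / 120 - Real.sin x := by
  refine nonneg_of_der_aux (fun x => x - x ^ 3 / 6 + x ^ 5 / 120 - Real.sin x)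
    (fun x => 1 - x ^ 2 / 2 + x ^ 4 / 24 - Real.cos x) (by simp) ?_ cos_upper_aux x hx
  intro z
  have := ((hasDerivAt_id z).sub (((hasDerivAt_id z).pow 3).div_const 6)).add
      (((hasDerivAt_id z).pow 5).div_const 120) |>.sub (Real.hasDerivAt_sin z)
  refine this.congr_deriv ?_
  simp only [id, Nat.cast_ofNat]
  norm_num
  ring

/-- For every real `y` with `0 ≤ y ≤ π`, `sin y ≤ y - y³/10`. -/
theorem sin_le_sub_cube_div_ten (y : ℝ) (h1 : 0 ≤ y) (h2 : y ≤ Real.pi) :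
    Real.sin y ≤ y - y ^ 3 / 10 := by
  rcases le_total y 2.82 with h | h
  · have h3 := sin_upper_aux y h1
    have h4 : 0 ≤ y ^ 3 * (8 - y ^ 2) := mul_nonneg (by positivity) (by norm_num at h; nlinarith)
    nlinarith
  · have h3 : Real.sin (Real.pi - y) ≤ Real.pi - y := Real.sin_le (by linarith)
    rw [Real.sin_pi_sub] at h3
    have p1 := Real.pi_gt_d2
    have p2 := Real.pi_lt_d2
    generalize Real.pi = p at *
    norm_num at h p1 p2
    obtain ⟨t, rfl⟩ : ∃ t, y = p - t := ⟨p - y, by ring⟩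
    have t0 : 0 ≤ t := by linarith
    have t1 : t ≤ 0.33 := by norm_num; linarith
    have q1 : 0 ≤ p * (10 - p ^ 2) := mul_nonneg (by linarith) (by nlinarith)
    norm_num at t1
    have q2 : 0 ≤ t * (3 * p ^ 2 - 20 - 3 * p * t) := mul_nonneg t0 (by nlinarith)
    have q3 : 0 ≤ t ^ 3 := by positivity
    nlinarith
end

section
/- Let n, m ∈ ℕ, A an n×n real matrix, B an n×m real matrix, C an m×n real matrix, and y* ∈ ℝᵐ with |y*_j| < π for all j. Define φ₀ : ℝⁿ → ℝᵐ by (φ₀(δ))_j := sin((Cδ)_j + y*_j) − sin(y*_j), the sector polynomials r_j(φ, δ) := (φ_j − η₁((Cδ)_j; y*_j))(φ_j − η₂((Cδ)_j; y*_j)), and the domain polynomials a_j(δ) := ((Cδ)_j + π + y*_j)((Cδ)_j − π + y*_j). Suppose there exist a real polynomial V in δ with V(0) = 0, vectors s₁, s₂ of m SOS polynomials in (φ, δ), and strictly positive definite polynomials σ₁, σ₂ in δ, such that V − σ₁ is SOS in δ and −∇V(δ)·(Aδ + Bφ) − σ₂(δ) + s₁(φ,δ)ᵀ r(φ,δ)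 + s₂(φ,δ)ᵀ a(δ) is SOS in (δ, φ). Then the origin (the pre-designed equilibrium of the microgrid interconnection) is asymptotically stable for δ̇ = Aδ + Bφ₀(δ): (i) for every ε > 0 there exists η > 0 such that every solution with ‖δ(0)‖ < η satisfies ‖δ(t)‖ < ε for all t ≥ 0, and (ii) there exists ρ > 0 such that every solution with ‖δ(0)‖ < ρ satisfies δ(t) → 0 as t → ∞. -/
open MvPolynomial Matrix

/-- A real multivariate polynomial is a sum of squares (SOS) if it is a finite
sum of squares of real polynomials. -/
def IsSOS {σ : Type*} (p : MvPolynomial σ ℝ) : Prop :=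
  ∃ (w : ℕ) (h : Fin w → MvPolynomial σ ℝ), p = ∑ i, (h i) ^ 2

/-- The Euclidean norm on `Fin k → ℝ`. -/
noncomputable def eNorm {k : ℕ} (x : Fin k → ℝ) : ℝ := Real.sqrt (∑ i, x i ^ 2)

/-- Lower bounding polynomial `η₁(y; c) = (y + c) − (y + c)³/6 − sin c`. -/
noncomputable def eta1 (y c : ℝ) : ℝ := (y + c) - (y + c) ^ 3 / 6 - Real.sin c

/-- Upper bounding polynomial `η₂(y; c) = (y + c) − (y + c)³/10 − sin c`. -/
noncomputable def eta2 (y c : ℝ) : ℝ := (y + c) - (y + c) ^ 3 / 10 - Real.sin c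

theorem cos_le_quartic {x : ℝ} (hx : 0 ≤ x) : Real.cos x ≤ 1 - x ^ 2 / 2 + x ^ 4 / 24 := by
  have h : AntitoneOn (fun x : ℝ => Real.cos x - (1 - x ^ 2 / 2 + x ^ 4 / 24)) (Set.Ici 0) := by
    apply antitoneOn_of_hasDerivWithinAt_nonpos (convex_Ici 0)
      (f' := fun x => -Real.sin x - (0 - 2 * x / 2 + 4 * x ^ 3 / 24)) (by fun_prop)
    · intro x hx
      apply HasDerivAt.hasDerivWithinAt
      refine (Real.hasDerivAt_cos x).sub (((hasDerivAt_const x (1:ℝ)).sub ?_).add ?_)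
      · simpa using (hasDerivAt_pow 2 x).div_const 2
      · simpa using (hasDerivAt_pow 4 x).div_const 24
    · intro x hx
      rw [interior_Ici] at hx
      have := Real.sin_ge_sub_cube (le_of_lt hx)
      linarith
  have := h (Set.mem_Ici.2 le_rfl) hx hx
  simp at this
  linarith

theorem sin_le_quintic {x : ℝ} (hx : 0 ≤ x) :
    Real.sin x ≤ x - x ^ 3 / 6 + x ^ 5 / 120 := by
  have h : AntitoneOn (fun x : ℝ => Real.sin x - (x - x ^ 3 / 6 + x ^ 5 / 120)) (Set.Ici 0) := by
    apply antitoneOn_of_hasDerivWithinAt_nonpos (convex_Ici 0)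
      (f' := fun x => Real.cos x - (1 - 3 * x ^ 2 / 6 + 5 * x ^ 4 / 120)) (by fun_prop)
    · intro x hx
      apply HasDerivAt.hasDerivWithinAt
      refine (Real.hasDerivAt_sin x).sub (((hasDerivAt_id x).sub ?_).add ?_)
      · simpa using (hasDerivAt_pow 3 x).div_const 6
      · simpa using (hasDerivAt_pow 5 x).div_const 120
    · intro x hx
      rw [interior_Ici] at hx
      have := cos_le_quartic (le_of_lt hx)
      linarith
  have := h (Set.mem_Ici.2 le_rfl) hx hx
  simp at this
  linarith

theorem sin_le_cubic {x : ℝ} (hx : 0 ≤ x) (hx' : x ≤ Real.pi) :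
    Real.sin x ≤ x - x ^ 3 / 10 := by
  have p1 := Real.pi_gt_d2
  have p2 := Real.pi_lt_d2
  rcases le_total x (2.8) with h | h
  · have := sin_le_quintic hx
    have h2 : x ^ 2 ≤ 8 := by nlinarith
    have : x ^ 3 * x ^ 2 ≤ x ^ 3 * 8 := mul_le_mul_of_nonneg_left h2 (by positivity)
    nlinarith
  · have h1 := Real.sin_le (x := Real.pi - x) (by linarith)
    rw [Real.sin_pi_sub] at h1
    have : x ^ 2 ≤ 3.15 ^ 2 := by nlinarith
    nlinarith [mul_nonneg (sub_nonneg.2 h) (by linarith : 0 ≤ 3.15 - x),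
      mul_nonneg (mul_nonneg (sub_nonneg.2 h) (by linarith : 0 ≤ 3.15 - x)) hx]

theorem sector_nonpos {z : ℝ} (hz : |z| ≤ Real.pi) :
    (Real.sin z - (z - z ^ 3 / 6)) * (Real.sin z - (z - z ^ 3 / 10)) ≤ 0 := by
  obtain ⟨h1, h2⟩ := abs_le.1 hz
  rcases le_total 0 z with h | h
  · have a := Real.sin_ge_sub_cube h
    have b := sin_le_cubic h h2
    exact mul_nonpos_of_nonneg_of_nonpos (by linarith) (by linarith)
  · have a := Real.sin_ge_sub_cube (x := -z) (by linarith)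
    have b := sin_le_cubic (x := -z) (by linarith) (by linarith)
    rw [Real.sin_neg] at a b
    have e : (-z) ^ 3 = - z ^ 3 := by ring
    rw [e] at a b
    exact mul_nonpos_of_nonpos_of_nonneg (by linarith) (by linarith)

theorem IsSOS.eval_nonneg {σ : Type*} {p : MvPolynomial σ ℝ} (h : IsSOS p) (x : σ → ℝ) :
    0 ≤ eval x p := by
  obtain ⟨w, g, rfl⟩ := h
  rw [map_sum]
  exact Finset.sum_nonneg fun i _ => by rw [map_pow]; positivity

theorem mvpoly_hasDerivWithinAt {n : ℕ} (p : MvPolynomial (Fin n) ℝ) {δ : ℝ → Fin n → ℝ}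
    {v : Fin n → ℝ} {s : Set ℝ} {t : ℝ} (h : HasDerivWithinAt δ v s t) :
    HasDerivWithinAt (fun t => eval (δ t) p) (∑ i, eval (δ t) (pderiv i p) * v i) s t := by
  induction p using MvPolynomial.induction_on with
  | C a => simpa using hasDerivWithinAt_const t s a
  | add p q hp hq =>
    have := hp.add hq
    have e : (fun t => eval (δ t) (p + q)) = (fun t => eval (δ t) p) + fun t => eval (δ t) q := by
      funext t
      simp
    rw [e]
    refine this.congr_deriv ?_
    simp [add_mul, Finset.sum_add_distrib]
  | mul_X p j hp =>
    have hj := hasDerivWithinAt_pi.1 h j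
    have := hp.mul hj
    have e : (fun t => eval (δ t) (p * X j)) = (fun t => eval (δ t) p) * fun t => δ t j := by
      funext t
      simp
    rw [e]
    refine this.congr_deriv ?_
    simp only [pderiv_mul, pderiv_X, map_add, map_mul, eval_X, add_mul, Finset.sum_add_distrib,
      Finset.sum_mul]
    congr 1
    · exact Finset.sum_congr rfl fun i _ => by ring
    · rw [Finset.sum_eq_single j]
      · simp
      · intro b _ hb
        simp [Pi.single_apply, hb.symm]
      · simp

theorem lyap_stab {n : ℕ} {V : (Fin n → ℝ) → ℝ} (hVc : Continuous V) (hV0 : V 0 = 0)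
    (hVp : ∀ x, x ≠ 0 → 0 < V x) {r : ℝ} {e : ℝ} (he : 0 < e) (her : e ≤ r) :
    ∃ η > 0, ∀ (δ : ℝ → Fin n → ℝ) (g : ℝ → ℝ), ContinuousOn δ (Set.Ici 0) →
      (∀ t ≥ 0, HasDerivWithinAt (fun t => V (δ t)) (g t) (Set.Ici 0) t) →
      (∀ t ≥ 0, ‖δ t‖ ≤ r → g t ≤ 0) → ∀ t₀ ≥ 0, ‖δ t₀‖ < η → ∀ t ≥ t₀, ‖δ t‖ < e := by
  obtain ⟨μ, hμ, hμV⟩ : ∃ μ > 0, ∀ x, ‖x‖ = e → μ ≤ V x := by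
    by_cases hne : (Metric.sphere (0 : Fin n → ℝ) e).Nonempty
    · obtain ⟨x, hx, hmin⟩ := (isCompact_sphere (0 : Fin n → ℝ) e).exists_isMinOn hne
        hVc.continuousOn
      refine ⟨V x, hVp x ?_, fun y hy => hmin (by simpa using hy)⟩
      rintro rfl
      simp at hx
      linarith
    · exact ⟨1, one_pos, fun x hx => (hne ⟨x, by simpa using hx⟩).elim⟩
  obtain ⟨η, hη, hηV⟩ := Metric.continuousAt_iff.1 (hVc.continuousAt (x := 0)) μ hμ
  refine ⟨min η e, lt_min hη he, ?_⟩
  intro δ g hδ hg hgn t₀ ht₀ h0 t ht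
  by_contra! hcon
  have hsub : ∀ {b}, Set.Icc t₀ b ⊆ Set.Ici 0 := fun {b} s hs => ht₀.le.trans hs.1
  have hnc : ContinuousOn (fun s => ‖δ s‖) (Set.Icc t₀ t) := (hδ.mono hsub).norm
  have hcpt : IsCompact (Set.Icc t₀ t ∩ (fun s => ‖δ s‖) ⁻¹' {e}) :=
    isCompact_Icc.of_isClosed_subset
      (hnc.preimage_isClosed_of_isClosed isClosed_Icc isClosed_singleton) Set.inter_subset_left
  have hne : (Set.Icc t₀ t ∩ (fun s => ‖δ s‖) ⁻¹' {e}).Nonempty := by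
    obtain ⟨s, hs, hse⟩ := intermediate_value_Icc ht hnc
      ⟨(h0.trans_le (min_le_right _ _)).le, hcon⟩
    exact ⟨s, hs, hse⟩
  obtain ⟨T, ⟨hT, hTe⟩, hleast⟩ := hcpt.exists_isLeast hne
  have hlt : ∀ s ∈ Set.Icc t₀ T, ‖δ s‖ ≤ e := by
    intro s hs
    by_contra! hc
    obtain ⟨u, hu, hue⟩ := intermediate_value_Icc hs.1
      (hnc.mono (Set.Icc_subset_Icc le_rfl (hs.2.trans hT.2)))
      ⟨(h0.trans_le (min_le_right _ _)).le, hc.le⟩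
    have := hleast ⟨⟨hu.1, hu.2.trans (hs.2.trans hT.2)⟩, hue⟩
    have : s = T := le_antisymm hs.2 (this.trans hu.2)
    subst this
    exact hc.ne' hTe
  have hanti : AntitoneOn (fun t => V (δ t)) (Set.Icc t₀ T) := by
    apply antitoneOn_of_hasDerivWithinAt_nonpos (convex_Icc _ _) (f' := g)
      (hVc.comp_continuousOn (hδ.mono hsub))
    · intro x hx
      exact (hg x (hsub (interior_subset hx))).mono (interior_subset.trans hsub)
    · intro x hx
      exact hgn x (hsub (interior_subset hx)) ((hlt x (interior_subset hx)).trans her)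
  have h1 := hanti ⟨le_rfl, hT.1⟩ ⟨hT.1, le_rfl⟩ hT.1
  have h2 := hμV (δ T) hTe
  have h3 := hηV (x := δ t₀) (by simpa using h0.trans_le (min_le_left _ _))
  rw [hV0, Real.dist_eq, sub_zero] at h3
  have := (abs_lt.1 h3).2
  simp only at h1
  linarith

theorem lyap_attr {n : ℕ} {V σ : (Fin n → ℝ) → ℝ} (hVc : Continuous V) (hV0 : V 0 = 0)
    (hVp : ∀ x, x ≠ 0 → 0 < V x) (hσc : Continuous σ) (hσp : ∀ x, x ≠ 0 → 0 < σ x)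
    {r : ℝ} (hr : 0 < r) :
    ∃ η > 0, ∀ (δ : ℝ → Fin n → ℝ) (g : ℝ → ℝ), ContinuousOn δ (Set.Ici 0) →
      (∀ t ≥ 0, HasDerivWithinAt (fun t => V (δ t)) (g t) (Set.Ici 0) t) →
      (∀ t ≥ 0, ‖δ t‖ ≤ r → g t ≤ 0) →
      (∀ t ≥ 0, ‖δ t‖ ≤ r → δ t ≠ 0 → g t ≤ - σ (δ t)) →
      ‖δ 0‖ < η → Filter.Tendsto δ Filter.atTop (nhds 0) := by
  obtain ⟨ρ, hρ, H⟩ := lyap_stab hVc hV0 hVp hr le_rfl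
  refine ⟨ρ, hρ, ?_⟩
  intro δ g hδ hg hgn hgσ h0
  have hb := H δ g hδ hg hgn 0 le_rfl h0
  rw [Metric.tendsto_atTop]
  intro ε hε
  obtain ⟨η, hη, H'⟩ := lyap_stab hVc hV0 hVp (lt_min hε hr) (min_le_right ε r)
  suffices h : ∃ t₀ ≥ 0, ‖δ t₀‖ < η by
    obtain ⟨t₀, ht₀, h⟩ := h
    refine ⟨t₀, fun t ht => ?_⟩
    rw [dist_zero_right]
    exact (H' δ g hδ hg hgn t₀ ht₀ h t ht).trans_le (min_le_left _ _)
  by_contra! hcon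
  have hK : IsCompact (Metric.closedBall (0 : Fin n → ℝ) r ∩ {x | η ≤ ‖x‖}) :=
    (isCompact_closedBall _ _).inter_right (isClosed_le continuous_const continuous_norm)
  have hmem : ∀ t ≥ 0, δ t ∈ Metric.closedBall (0 : Fin n → ℝ) r ∩ {x | η ≤ ‖x‖} :=
    fun t ht => ⟨by simpa using (hb t ht).le, hcon t ht⟩
  obtain ⟨x, hx, hmin⟩ := hK.exists_isMinOn ⟨_, hmem 0 le_rfl⟩ hσc.continuousOn
  have hne : ∀ y : Fin n → ℝ, η ≤ ‖y‖ → y ≠ 0 := by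
    rintro y hy rfl
    simp at hy
    linarith
  have hc := hσp x (hne x hx.2)
  set c := σ x
  have hanti : AntitoneOn (fun t => V (δ t) + c * t) (Set.Ici 0) := by
    apply antitoneOn_of_hasDerivWithinAt_nonpos (convex_Ici _) (f' := fun t => g t + c)
      ((hVc.comp_continuousOn hδ).add (by fun_prop))
    · intro t ht
      refine ((hg t (interior_subset ht)).mono interior_subset).add ?_
      simpa using (hasDerivWithinAt_id t _).const_mul c
    · intro t ht
      have ht' : 0 ≤ t := interior_subset ht
      have h1 := hgσ t ht' (hb t ht').le (hne _ (hcon t ht'))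
      have h2 : c ≤ σ (δ t) := hmin (hmem t ht')
      linarith
  have hT : 0 ≤ V (δ 0) / c + 1 := by
    have := hVp _ (hne _ (hcon 0 le_rfl))
    positivity
  have h1 := hanti (Set.mem_Ici.2 le_rfl) hT hT
  have h2 := hVp _ (hne _ (hcon _ hT))
  simp only [mul_zero, add_zero, mul_add, mul_one, mul_div_cancel₀ _ hc.ne'] at h1
  linarith

theorem norm_le_eNorm {k : ℕ} (x : Fin k → ℝ) : ‖x‖ ≤ eNorm x := by
  unfold eNorm
  rw [pi_norm_le_iff_of_nonneg (Real.sqrt_nonneg _)]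
  intro i
  exact Real.abs_le_sqrt (Finset.single_le_sum (f := fun i => x i ^ 2)
    (fun i _ => sq_nonneg _) (Finset.mem_univ i))

theorem eNorm_small {k : ℕ} {ε : ℝ} (hε : 0 < ε) :
    ∃ e > 0, ∀ x : Fin k → ℝ, ‖x‖ < e → eNorm x < ε := by
  have hc : Continuous (eNorm : (Fin k → ℝ) → ℝ) := by
    unfold eNorm
    fun_prop
  obtain ⟨e, he, h⟩ := Metric.continuousAt_iff.1 (hc.continuousAt (x := 0)) ε hε
  refine ⟨e, he, fun x hx => ?_⟩
  have := h (x := x) (by simpa using hx)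
  have h0 : eNorm (0 : Fin k → ℝ) = 0 := by simp [eNorm]
  rw [h0, Real.dist_eq, sub_zero] at this
  exact (abs_lt.1 this).2

/-- For the microgrid interconnection `δ̇ = Aδ + Bφ₀(δ)` with the
componentwise sinusoidal nonlinearity `(φ₀(δ))_j = sin((Cδ)_j + y*_j) − sin(y*_j)`
(`|y*_j| < π`), the sector constraints
`r_j(φ, δ) = (φ_j − η₁((Cδ)_j; y*_j))(φ_j − η₂((Cδ)_j; y*_j))` and the domain
constraints `a_j(δ) = ((Cδ)_j + π + y*_j)((Cδ)_j − π + y*_j)`: if there are a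
polynomial `V` with `V(0) = 0`, SOS multiplier vectors `s₁, s₂`, and strictly
positive definite polynomials `σ₁, σ₂` such that `V − σ₁` is SOS and
`−∇V(δ)·(Aδ + Bφ) − σ₂(δ) + s₁ᵀr + s₂ᵀa` is SOS in `(δ, φ)`, then the origin
(the pre-designed equilibrium) is asymptotically stable:
(i) Lyapunov stability and (ii) local attractivity hold.
Polynomials in `(φ, δ)` are indexed by `Fin m ⊕ Fin n` (`inl` = `φ`-variables,
`inr` = `δ`-variables); norms are Euclidean. -/
theorem microgrid_sos_asymptotic_stability (n m : ℕ)
    (A : Matrix (Fin n) (Fin n) ℝ) (B : Matrix (Fin n) (Fin m) ℝ)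
    (C : Matrix (Fin m) (Fin n) ℝ) (ystar : Fin m → ℝ)
    (hystar : ∀ j, |ystar j| < Real.pi)
    (φ₀ : (Fin n → ℝ) → (Fin m → ℝ))
    (hφ₀ : ∀ (δ : Fin n → ℝ) (j : Fin m),
      φ₀ δ j = Real.sin (C.mulVec δ j + ystar j) - Real.sin (ystar j))
    (rFun : Fin m → (Fin m → ℝ) → (Fin n → ℝ) → ℝ)
    (hr : ∀ (j : Fin m) (φ : Fin m → ℝ) (δ : Fin n → ℝ),
      rFun j φ δ = (φ j - eta1 (C.mulVec δ j) (ystar j)) *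
        (φ j - eta2 (C.mulVec δ j) (ystar j)))
    (aFun : Fin m → (Fin n → ℝ) → ℝ)
    (ha : ∀ (j : Fin m) (δ : Fin n → ℝ),
      aFun j δ = (C.mulVec δ j + Real.pi + ystar j) *
        (C.mulVec δ j - Real.pi + ystar j))
    (V : MvPolynomial (Fin n) ℝ) (hV0 : eval (0 : Fin n → ℝ) V = 0)
    (s₁ s₂ : Fin m → MvPolynomial (Fin m ⊕ Fin n) ℝ)
    (hs₁ : ∀ j, IsSOS (s₁ j)) (hs₂ : ∀ j, IsSOS (s₂ j))
    (σ₁ σ₂ : MvPolynomial (Fin n) ℝ)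
    (hσ₁ : ∀ x : Fin n → ℝ, x ≠ 0 → 0 < eval x σ₁)
    (hσ₂ : ∀ x : Fin n → ℝ, x ≠ 0 → 0 < eval x σ₂)
    (hVσ₁ : IsSOS (V - σ₁))
    (hSOS : ∃ q : MvPolynomial (Fin m ⊕ Fin n) ℝ, IsSOS q ∧
      ∀ (φ : Fin m → ℝ) (δ : Fin n → ℝ),
        eval (Sum.elim φ δ) q =
          -(∑ i, eval δ (pderiv i V) * (A.mulVec δ + B.mulVec φ) i)
            - eval δ σ₂
            + ∑ j, eval (Sum.elim φ δ) (s₁ j) * rFun j φ δ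
            + ∑ j, eval (Sum.elim φ δ) (s₂ j) * aFun j δ) :
    (∀ ε > 0, ∃ η > 0, ∀ δ : ℝ → (Fin n → ℝ),
        (∀ t ≥ (0 : ℝ), HasDerivWithinAt δ
          (A.mulVec (δ t) + B.mulVec (φ₀ (δ t))) (Set.Ici 0) t) →
        eNorm (δ 0) < η → ∀ t ≥ (0 : ℝ), eNorm (δ t) < ε) ∧
    (∃ ρ > 0, ∀ δ : ℝ → (Fin n → ℝ),
        (∀ t ≥ (0 : ℝ), HasDerivWithinAt δ
          (A.mulVec (δ t) + B.mulVec (φ₀ (δ t))) (Set.Ici 0) t) →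
        eNorm (δ 0) < ρ → Filter.Tendsto δ Filter.atTop (nhds 0)) := by
  obtain ⟨q, hq, hqe⟩ := hSOS
  have hVc : Continuous fun x => eval x V := MvPolynomial.continuous_eval V
  have hσc : Continuous fun x => eval x σ₂ := MvPolynomial.continuous_eval σ₂
  have hVp : ∀ x : Fin n → ℝ, x ≠ 0 → 0 < eval x V := by
    intro x hx
    have := hVσ₁.eval_nonneg x
    rw [map_sub] at this
    linarith [hσ₁ x hx]
  obtain ⟨r, hr0, hrC⟩ : ∃ r > 0, ∀ x : Fin n → ℝ, ‖x‖ ≤ r →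
      ∀ j, |C.mulVec x j + ystar j| ≤ Real.pi := by
    have hev : ∀ᶠ x in nhds (0 : Fin n → ℝ), ∀ j, |C.mulVec x j + ystar j| < Real.pi := by
      rw [Filter.eventually_all]
      intro j
      have hc : Continuous fun x : Fin n → ℝ => |C.mulVec x j + ystar j| := by
        have : Continuous fun x : Fin n → ℝ => C.mulVec x := by fun_prop
        fun_prop
      exact hc.continuousAt.eventually_lt continuousAt_const (by simpa using hystar j)
    obtain ⟨r, hr0, h⟩ := Metric.eventually_nhds_iff.1 hev
    refine ⟨r / 2, by positivity, fun x hx j => (h (y := x) ?_ j).le⟩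
    rw [dist_zero_right]
    linarith
  set G : (Fin n → ℝ) → ℝ := fun x =>
    ∑ i, eval x (pderiv i V) * (A.mulVec x + B.mulVec (φ₀ x)) i with hG
  have hGσ : ∀ x, ‖x‖ ≤ r → G x ≤ - eval x σ₂ := by
    intro x hx
    have h1 := hqe (φ₀ x) x
    have h2 := hq.eval_nonneg (Sum.elim (φ₀ x) x)
    have h3 : ∑ j, eval (Sum.elim (φ₀ x) x) (s₁ j) * rFun j (φ₀ x) x ≤ 0 := by
      refine Finset.sum_nonpos fun j _ =>
        mul_nonpos_of_nonneg_of_nonpos ((hs₁ j).eval_nonneg _) ?_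
      have := sector_nonpos (hrC x hx j)
      rw [hr, hφ₀, eta1, eta2]
      refine le_of_eq_of_le ?_ this
      ring
    have h4 : ∑ j, eval (Sum.elim (φ₀ x) x) (s₂ j) * aFun j x ≤ 0 := by
      refine Finset.sum_nonpos fun j _ =>
        mul_nonpos_of_nonneg_of_nonpos ((hs₂ j).eval_nonneg _) ?_
      obtain ⟨a, b⟩ := abs_le.1 (hrC x hx j)
      rw [ha]
      exact mul_nonpos_of_nonneg_of_nonpos (by linarith) (by linarith)
    simp only [hG]
    linarith
  have hφ0 : φ₀ 0 = 0 := by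
    funext j
    simp [hφ₀]
  have hGn : ∀ x, ‖x‖ ≤ r → G x ≤ 0 := by
    intro x hx
    by_cases h : x = 0
    · subst h
      simp [hG, hφ0]
    · linarith [hGσ x hx, hσ₂ x h]
  constructor
  · intro ε hε
    obtain ⟨e, he, hee⟩ := eNorm_small (k := n) hε
    obtain ⟨η, hη, H⟩ := lyap_stab hVc hV0 hVp (lt_min he hr0) (min_le_right e r)
    refine ⟨η, hη, fun δ hδ h0 t ht => hee _ ?_⟩
    refine (H δ (fun t => G (δ t)) (fun t ht => (hδ t ht).continuousWithinAt)
      (fun t ht => mvpoly_hasDerivWithinAt V (hδ t ht)) (fun t ht h => hGn _ h) 0 le_rfl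
      ((norm_le_eNorm _).trans_lt h0) t ht).trans_le (min_le_left _ _)
  · obtain ⟨η, hη, H⟩ := lyap_attr hVc hV0 hVp hσc hσ₂ hr0
    refine ⟨η, hη, fun δ hδ h0 => ?_⟩
    exact H δ (fun t => G (δ t)) (fun t ht => (hδ t ht).continuousWithinAt)
      (fun t ht => mvpoly_hasDerivWithinAt V (hδ t ht)) (fun t ht h => hGn _ h)
      (fun t ht h _ => hGσ _ h) ((norm_le_eNorm _).trans_lt h0)
end
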